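/- Implicit pessimism of posterior sampling: suppose Assumption LCB holds. Let P ∼ β(·|D) be a single draw from the posterior and π(P) its optimal policy. Then the Bayesian suboptimality gap satisfies E[ V^{π(P*)}_{P*} − V^{π(P)}_{P*} ] ≤ E[ V^{π(P*)}_{P*} − L(π(P*); D) ] + 2δH, where the outer expectations are over P* ∼ β, the dataset D generated from P*, and P ∼ β(·|D). -/

import Mathlib

open Finset
open scoped BigOperators Classical

noncomputable section

namespace RL

/-- A transition model: a (candidate) conditional distribution over next states. -/
abbrev Trans (S A : Type) : Type := S → A → S → ℝ

/-- A (Markovian, stochastic) policy. -/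
abbrev Pol (S A : Type) : Type := S → A → ℝ

/-- `p` is a probability distribution on a finite type. -/
def IsDist {X : Type} [Fintype X] (p : X → ℝ) : Prop :=
  (∀ x, 0 ≤ p x) ∧ ∑ x, p x = 1

def IsTrans {S A : Type} [Fintype S] (P : Trans S A) : Prop :=
  ∀ s a, IsDist (P s a)

def IsPol {S A : Type} [Fintype A] (π : Pol S A) : Prop :=
  ∀ s, IsDist (π s)

variable {S A : Type} [Fintype S] [Fintype A]

/-- Value function with `h` steps to go. -/
def vAux (P : Trans S A) (π : Pol S A) (r : S → A → ℝ) : ℕ → S → ℝ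
  | 0 => fun _ => 0
  | (h + 1) => fun s => ∑ a, π s a * (r s a + ∑ s', P s a s' * vAux P π r h s')

/-- `V^π_P`: expected cumulative reward over `H` steps from initial distribution `d0`. -/
def V (P : Trans S A) (π : Pol S A) (r : S → A → ℝ) (d0 : S → ℝ) (H : ℕ) : ℝ :=
  ∑ s, d0 s * vAux P π r H s

/-- State distribution at step `t` under policy `π` and transition `P`. -/
def sDist (P : Trans S A) (π : Pol S A) (d0 : S → ℝ) : ℕ → S → ℝ
  | 0 => d0
  | (t + 1) => fun s' => ∑ s, ∑ a, sDist P π d0 t s * π s a * P s a s'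

/-- `d^π_P`: average state-action occupancy distribution over horizon `H`. -/
def occ (P : Trans S A) (π : Pol S A) (d0 : S → ℝ) (H : ℕ) (s : S) (a : A) : ℝ :=
  (1 / (H : ℝ)) * ∑ t ∈ Finset.range H, sDist P π d0 t s * π s a

/-- ℓ₁ distance between two (signed) distributions on a finite type. -/
def l1 {X : Type} [Fintype X] (p q : X → ℝ) : ℝ := ∑ x, |p x - q x|

/-- Expectation of `f` under a distribution on `S × A` given in curried form. -/
def expSA (μ : S → A → ℝ) (f : S → A → ℝ) : ℝ := ∑ s, ∑ a, μ s a * f s a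

/-- An offline dataset of `n` tuples `(s, a, s')`. -/
abbrev Data (S A : Type) (n : ℕ) : Type := Fin n → S × A × S

/-- Empirical average `E_D[f(s,a,s')]`. -/
def emp {n : ℕ} (D : Data S A n) (f : S → A → S → ℝ) : ℝ :=
  (1 / (n : ℝ)) * ∑ i, f (D i).1 (D i).2.1 (D i).2.2

/-- Likelihood of the dataset `D` when `(s,a) ∼ ρ` i.i.d. and `s' ∼ P(·|s,a)`. -/
def dataLik (ρ : S → A → ℝ) (P : Trans S A) {n : ℕ} (D : Data S A n) : ℝ :=
  ∏ i, ρ (D i).1 (D i).2.1 * P (D i).1 (D i).2.1 (D i).2.2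

/-- Probability of the event `E` over the random draw of the offline dataset. -/
def dataProb (ρ : S → A → ℝ) (P : Trans S A) (n : ℕ) (E : Data S A n → Prop) : ℝ :=
  ∑ D : Data S A n, if E D then dataLik ρ P D else 0

/-- `Phat` is a maximum-likelihood estimator over the class `M` on the dataset `D`. -/
def IsMLE (M : Set (Trans S A)) {n : ℕ} (D : Data S A n) (Phat : Trans S A) : Prop :=
  Phat ∈ M ∧
    ∀ P ∈ M, emp D (fun s a s' => Real.log (P s a s'))
      ≤ emp D (fun s a s' => Real.log (Phat s a s'))

/-- Membership in the version space `M_D` with threshold `ξ`. -/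
def inVS (M : Set (Trans S A)) {n : ℕ} (D : Data S A n) (Phat : Trans S A) (ξ : ℝ)
    (P : Trans S A) : Prop :=
  P ∈ M ∧ emp D (fun s a _ => (l1 (P s a) (Phat s a)) ^ 2) ≤ ξ

/-- Pessimistic policy evaluation: `min_{P ∈ M_D} V^π_P`. -/
def pess (M : Set (Trans S A)) {n : ℕ} (D : Data S A n) (Phat : Trans S A) (ξ : ℝ)
    (r : S → A → ℝ) (d0 : S → ℝ) (H : ℕ) (π : Pol S A) : ℝ :=
  sInf {v | ∃ P, inVS M D Phat ξ P ∧ v = V P π r d0 H}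

/-- `πhat` is an output of CPPO: a maximizer over all policies of the pessimistic value. -/
def IsCPPO (M : Set (Trans S A)) {n : ℕ} (D : Data S A n) (Phat : Trans S A) (ξ : ℝ)
    (r : S → A → ℝ) (d0 : S → ℝ) (H : ℕ) (πhat : Pol S A) : Prop :=
  IsPol πhat ∧ ∀ π, IsPol π → pess M D Phat ξ r d0 H π ≤ pess M D Phat ξ r d0 H πhat

end RL

namespace RL

variable {S A : Type} [Fintype S] [Fintype A]

/-- The uniform policy. -/
def uniformPol (S A : Type) [Fintype A] : Pol S A := fun _ _ => 1 / (Fintype.card A : ℝ)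

/-- State-action value with `H` steps to go. -/
def Qf (P : Trans S A) (π : Pol S A) (r : S → A → ℝ) : ℕ → S → A → ℝ
  | 0 => fun _ _ => 0
  | (h + 1) => fun s a => r s a + ∑ s', P s a s' * vAux P π r h s'

/-- Advantage function `A^π_P = Q^π_P - V^π_P` (with `H` steps to go). -/
def Adv (P : Trans S A) (π : Pol S A) (r : S → A → ℝ) (H : ℕ) (s : S) (a : A) : ℝ :=
  Qf P π r H s a - vAux P π r H s

/-- The PS-PO policy iterates: `π₀` uniform and
`π_{t+1}(a|s) ∝ π_t(a|s) exp (η A^{π_t}_{P_t}(s,a))`. -/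
def psPol (r : S → A → ℝ) (H : ℕ) (η : ℝ) (Ps : ℕ → Trans S A) : ℕ → Pol S A
  | 0 => uniformPol S A
  | (t + 1) => fun s a =>
      psPol r H η Ps t s a * Real.exp (η * Adv (Ps t) (psPol r H η Ps t) r H s a) /
        ∑ a', psPol r H η Ps t s a' * Real.exp (η * Adv (Ps t) (psPol r H η Ps t) r H s a')

/-- Extend a finite tuple of models (from the class `M`) to a sequence. -/
def seqOf {T : ℕ} (M : Finset (Trans S A)) (Ps : Fin T → {P // P ∈ M}) : ℕ → Trans S A :=
  fun k => if h : k < T then (Ps ⟨k, h⟩).1 else fun _ _ _ => 0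

/-- Posterior probability of the model `P` given the dataset `D`, for a prior `β`
supported on the finite class `M`. -/
def post (β : Trans S A → ℝ) (M : Finset (Trans S A)) (ρ : S → A → ℝ) {n : ℕ}
    (D : Data S A n) (P : Trans S A) : ℝ :=
  β P * dataLik ρ P D / ∑ P' ∈ M, β P' * dataLik ρ P' D

/-- Bayesian expectation: `P* ∼ β`, `D` generated from `P*`, and `T` i.i.d. posterior
samples `P_0, …, P_{T-1} ∼ β(·|D)`. -/
def bayesExp (β : Trans S A → ℝ) (M : Finset (Trans S A)) (ρ : S → A → ℝ) (n T : ℕ)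
    (f : Trans S A → Data S A n → (ℕ → Trans S A) → ℝ) : ℝ :=
  ∑ Pst ∈ M, β Pst * ∑ D : Data S A n, dataLik ρ Pst D *
    ∑ Ps : Fin T → {P // P ∈ M},
      (∏ t, post β M ρ D (Ps t).1) * f Pst D (seqOf M Ps)

/-- `β` is a prior distribution supported on the finite class `M`. -/
def IsPrior (β : Trans S A → ℝ) (M : Finset (Trans S A)) : Prop :=
  (∀ P, 0 ≤ β P) ∧ ∑ P ∈ M, β P = 1

/-- Assumption LCB: `L(·;D)` is a `[0,H]`-valued lower confidence bound on `V^π_{P*}`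
holding uniformly over policies with probability at least `1-δ`, for every model in
the support of the prior. -/
def IsLCB (M : Finset (Trans S A)) (β : Trans S A → ℝ) (ρ : S → A → ℝ)
    (r : S → A → ℝ) (d0 : S → ℝ) (H n : ℕ) (δ : ℝ)
    (L : Data S A n → Pol S A → ℝ) : Prop :=
  (∀ D π, 0 ≤ L D π ∧ L D π ≤ (H : ℝ)) ∧
    ∀ P ∈ M, 0 < β P →
      1 - δ ≤ dataProb ρ P n (fun D => ∀ π, IsPol π → L D π ≤ V P π r d0 H)

/-- `opt` is a selection of optimal policies: `opt P = π(P) = argmax_π V^π_P`. -/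
def IsOptSel {S A : Type} [Fintype S] [Fintype A] (r : S → A → ℝ) (d0 : S → ℝ) (H : ℕ)
    (opt : Trans S A → Pol S A) : Prop :=
  ∀ P, IsPol (opt P) ∧ ∀ π, IsPol π → V P π r d0 H ≤ V P (opt P) r d0 H

/-- Average state occupancy distribution of `π` under `P`. -/
def sOcc (P : Trans S A) (π : Pol S A) (d0 : S → ℝ) (H : ℕ) (s : S) : ℝ :=
  (1 / (H : ℝ)) * ∑ t ∈ Finset.range H, sDist P π d0 t s

/-- Kullback–Leibler divergence between two distributions on `A`. -/
def KLd {A : Type} [Fintype A] (p q : A → ℝ) : ℝ := ∑ a, p a * Real.log (p a / q a)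

end RL

open RL

namespace RL

variable {S A : Type} [Fintype S] [Fintype A]

lemma vAux_nonneg {P : Trans S A} {π : Pol S A} {r : S → A → ℝ} (hP : IsTrans P)
    (hπ : IsPol π) (hr : ∀ s a, 0 ≤ r s a) (h : ℕ) (s : S) : 0 ≤ vAux P π r h s := by
  induction h generalizing s with
  | zero => exact le_rfl
  | succ h ih =>
    exact Finset.sum_nonneg fun a _ => mul_nonneg ((hπ s).1 a) <| add_nonneg (hr s a) <|
      Finset.sum_nonneg fun s' _ => mul_nonneg ((hP s a).1 s') (ih s')

lemma V_nonneg {P : Trans S A} {π : Pol S A} {r : S → A → ℝ} {d0 : S → ℝ} (hP : IsTrans P)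
    (hπ : IsPol π) (hr : ∀ s a, 0 ≤ r s a) (hd0 : IsDist d0) (H : ℕ) : 0 ≤ V P π r d0 H :=
  Finset.sum_nonneg fun s _ => mul_nonneg (hd0.1 s) (vAux_nonneg hP hπ hr H s)

lemma dataLik_nonneg {ρ : S → A → ℝ} {P : Trans S A}
    (hρ : IsDist (fun p : S × A => ρ p.1 p.2)) (hP : IsTrans P) {n : ℕ} (D : Data S A n) :
    0 ≤ dataLik ρ P D :=
  Finset.prod_nonneg fun i _ =>
    mul_nonneg (hρ.1 ((D i).1, (D i).2.1)) ((hP (D i).1 (D i).2.1).1 (D i).2.2)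

lemma sum_dataLik {ρ : S → A → ℝ} {P : Trans S A}
    (hρ : IsDist (fun p : S × A => ρ p.1 p.2)) (hP : IsTrans P) (n : ℕ) :
    ∑ D : Data S A n, dataLik ρ P D = 1 := by
  have hone : ∑ x : S × A × S, ρ x.1 x.2.1 * P x.1 x.2.1 x.2.2 = 1 := by
    have hsum := hρ.2
    rw [Fintype.sum_prod_type] at hsum
    simp_rw [Fintype.sum_prod_type, ← Finset.mul_sum, (hP _ _).2, mul_one]
    exact hsum
  have hprod := Finset.prod_univ_sum (fun _ : Fin n => (Finset.univ : Finset (S × A × S)))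
    (fun _ x => ρ x.1 x.2.1 * P x.1 x.2.1 x.2.2)
  rw [Fintype.piFinset_univ] at hprod
  simpa [hone, dataLik] using hprod.symm

lemma post_nonneg {β : Trans S A → ℝ} {M : Finset (Trans S A)} {ρ : S → A → ℝ}
    (hβ : ∀ P, 0 ≤ β P) (hρ : IsDist (fun p : S × A => ρ p.1 p.2))
    (hM : ∀ P ∈ M, IsTrans P) {n : ℕ} (D : Data S A n) {P : Trans S A} (hP : P ∈ M) :
    0 ≤ post β M ρ D P :=
  div_nonneg (mul_nonneg (hβ P) (dataLik_nonneg hρ (hM P hP) D)) <|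
    Finset.sum_nonneg fun Q hQ => mul_nonneg (hβ Q) (dataLik_nonneg hρ (hM Q hQ) D)

lemma sum_post_le_one (β : Trans S A → ℝ) (M : Finset (Trans S A)) (ρ : S → A → ℝ)
    {n : ℕ} (D : Data S A n) : ∑ P ∈ M, post β M ρ D P ≤ 1 := by
  simp only [post, ← Finset.sum_div]
  exact div_self_le_one _

lemma bayesExp_sub (β : Trans S A → ℝ) (M : Finset (Trans S A)) (ρ : S → A → ℝ) (n T : ℕ)
    (f g : Trans S A → Data S A n → (ℕ → Trans S A) → ℝ) :
    bayesExp β M ρ n T (fun Pst D Ps => f Pst D Ps - g Pst D Ps) =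
      bayesExp β M ρ n T f - bayesExp β M ρ n T g := by
  simp only [bayesExp, mul_sub, Finset.sum_sub_distrib]

lemma bayesExp_one (β : Trans S A → ℝ) (M : Finset (Trans S A)) (ρ : S → A → ℝ) (n : ℕ)
    (g : Trans S A → Data S A n → Trans S A → ℝ) :
    bayesExp β M ρ n 1 (fun Pst D Ps => g Pst D (Ps 0)) =
      ∑ Pst ∈ M, β Pst * ∑ D : Data S A n, dataLik ρ Pst D *
        ∑ P ∈ M, post β M ρ D P * g Pst D P := by
  refine Finset.sum_congr rfl fun Pst _ => congrArg _ <| Finset.sum_congr rfl fun D _ =>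
    congrArg _ ?_
  rw [← Finset.sum_coe_sort M]
  exact Fintype.sum_equiv (Equiv.funUnique (Fin 1) {P // P ∈ M}) _ _ fun Ps => by
    simp [seqOf]

/-- The ground truth and a single posterior draw are exchangeable. -/
lemma bayesExp_one_swap (β : Trans S A → ℝ) (M : Finset (Trans S A)) (ρ : S → A → ℝ) (n : ℕ)
    (g : Trans S A → Data S A n → Trans S A → ℝ) :
    bayesExp β M ρ n 1 (fun Pst D Ps => g Pst D (Ps 0)) =
      bayesExp β M ρ n 1 (fun Pst D Ps => g (Ps 0) D Pst) := by
  rw [bayesExp_one, bayesExp_one β M ρ n (fun Pst D P => g P D Pst)]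
  simp only [Finset.mul_sum]
  rw [Finset.sum_comm]
  conv_rhs => rw [Finset.sum_comm]
  refine Finset.sum_congr rfl fun D _ => ?_
  rw [Finset.sum_comm]
  refine Finset.sum_congr rfl fun P _ => Finset.sum_congr rfl fun Q _ => ?_
  simp only [post]
  ring

/-- On average, a lower confidence bound at the policy selected by a posterior draw
overestimates its true value by at most `δ * H`. -/
lemma IsLCB.neg_le_bayesExp_sub {M : Finset (Trans S A)} {β : Trans S A → ℝ}
    {ρ : S → A → ℝ} {r : S → A → ℝ} {d0 : S → ℝ} {H n : ℕ} {δ : ℝ}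
    {L : Data S A n → Pol S A → ℝ} (hL : IsLCB M β ρ r d0 H n δ L)
    (hM : ∀ P ∈ M, IsTrans P) (hβ : IsPrior β M)
    (hρ : IsDist (fun p : S × A => ρ p.1 p.2)) (hd0 : IsDist d0) (hr : ∀ s a, 0 ≤ r s a)
    {sel : Trans S A → Pol S A} (hsel : ∀ P, IsPol (sel P)) :
    -(δ * H) ≤ bayesExp β M ρ n 1 (fun Pst D Ps =>
      V Pst (sel (Ps 0)) r d0 H - L D (sel (Ps 0))) := by
  rw [bayesExp_one β M ρ n (fun Pst D P => V Pst (sel P) r d0 H - L D (sel P))]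
  have hH : (0 : ℝ) ≤ H := H.cast_nonneg
  have hinner : ∀ Pst ∈ M, ∀ D : Data S A n,
      (if ∀ π, IsPol π → L D π ≤ V Pst π r d0 H then (H : ℝ) else 0) - H ≤
        ∑ P ∈ M, post β M ρ D P * (V Pst (sel P) r d0 H - L D (sel P)) := by
    intro Pst hPst D
    split_ifs with hgood
    · rw [sub_self]
      exact Finset.sum_nonneg fun P hP => mul_nonneg (post_nonneg hβ.1 hρ hM D hP)
        (sub_nonneg.2 (hgood _ (hsel P)))
    · calc (0 : ℝ) - H ≤ (∑ P ∈ M, post β M ρ D P) * -H := by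
            nlinarith [sum_post_le_one β M ρ D]
        _ ≤ _ := by
          rw [Finset.sum_mul]
          refine Finset.sum_le_sum fun P hP =>
            mul_le_mul_of_nonneg_left ?_ (post_nonneg hβ.1 hρ hM D hP)
          linarith [V_nonneg (hM Pst hPst) (hsel P) hr hd0 H, (hL.1 D (sel P)).2]
  calc -(δ * H) = ∑ Pst ∈ M, β Pst * -(δ * H) := by rw [← Finset.sum_mul, hβ.2, one_mul]
    _ ≤ _ := Finset.sum_le_sum fun Pst hPst => ?_
  rcases (hβ.1 Pst).eq_or_lt with h0 | hpos
  · simp [← h0]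
  refine mul_le_mul_of_nonneg_left ?_ hpos.le
  calc -(δ * H) ≤ dataProb ρ Pst n (fun D => ∀ π, IsPol π → L D π ≤ V Pst π r d0 H) * H
          - 1 * H := by nlinarith [hL.2 Pst hPst hpos]
    _ = ∑ D : Data S A n, dataLik ρ Pst D *
          ((if ∀ π, IsPol π → L D π ≤ V Pst π r d0 H then (H : ℝ) else 0) - H) := by
        rw [← sum_dataLik hρ (hM Pst hPst) n, dataProb, Finset.sum_mul, Finset.sum_mul,
          ← Finset.sum_sub_distrib]
        refine Finset.sum_congr rfl fun D _ => ?_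
        split_ifs <;> ring
    _ ≤ _ := Finset.sum_le_sum fun D _ =>
        mul_le_mul_of_nonneg_left (hinner Pst hPst D) (dataLik_nonneg hρ (hM Pst hPst) D)

end RL

/-- implicit pessimism of posterior sampling: for a single posterior
draw `P ∼ β(·|D)`,
`E[V^{π(P*)}_{P*} - V^{π(P)}_{P*}] ≤ E[V^{π(P*)}_{P*} - L(π(P*);D)] + 2δH`. -/
theorem posterior_sampling_implicit_pessimism
    (S A : Type) [Fintype S] [Fintype A]
    (M : Finset (Trans S A)) (β : Trans S A → ℝ) (ρ : S → A → ℝ)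
    (r : S → A → ℝ) (d0 : S → ℝ) (H n : ℕ) (δ : ℝ)
    (opt : Trans S A → Pol S A) (L : Data S A n → Pol S A → ℝ)
    (hM : ∀ P ∈ M, IsTrans P)
    (hβ : IsPrior β M)
    (hρ : IsDist (fun p : S × A => ρ p.1 p.2))
    (hd0 : IsDist d0)
    (hr : ∀ s a, 0 ≤ r s a ∧ r s a ≤ 1)
    (hopt : IsOptSel r d0 H opt)
    (hδ : 0 ≤ δ)
    (hL : IsLCB M β ρ r d0 H n δ L) :
    bayesExp β M ρ n 1 (fun Pst D Ps =>
        V Pst (opt Pst) r d0 H - V Pst (opt (Ps 0)) r d0 H)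
      ≤ bayesExp β M ρ n 1 (fun Pst D _ =>
          V Pst (opt Pst) r d0 H - L D (opt Pst)) + 2 * δ * (H : ℝ) := by
  have hgap := hL.neg_le_bayesExp_sub hM hβ hρ hd0 (fun s a => (hr s a).1)
    (fun P => (hopt P).1)
  have hswap := bayesExp_one_swap β M ρ n (fun Pst D _ => L D (opt Pst))
  have hδH : 0 ≤ δ * (H : ℝ) := mul_nonneg hδ H.cast_nonneg
  rw [bayesExp_sub] at hgap
  rw [bayesExp_sub, bayesExp_sub]
  linarith
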